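/- arXiv:2208.04380 — 5 statements merged into one kernel-verified Lean document; each statement's English description precedes it below -/
import Mathlib

section
/- Let σ be a maximal overlapped repeat in a word w. Then fact(σ) is a maximal repetition in w whose minimal period divides p(σ). -/
variable {A : Type*}

/-- `p` is a period of the factor `w[i..j]` of the word `w` (positions are 1-based):
`1 ≤ p ≤ j - i + 1` and `w[k] = w[k+p]` whenever both positions lie in `[i, j]`. -/
def IsPeriodOf (w : ℕ → A) (i j p : ℕ) : Prop :=
  1 ≤ p ∧ p ≤ j - i + 1 ∧ ∀ k, i ≤ k → k + p ≤ j → w k = w (k + p)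

/-- The minimal period of the factor `w[i..j]`. -/
noncomputable def minPer (w : ℕ → A) (i j : ℕ) : ℕ :=
  sInf {p | IsPeriodOf w i j p}

/-- The maximality conditions for a factor `w[i..j]` of the word `w` of length `n`,
with respect to its minimal period: it cannot be extended to the left or to the right
by one letter preserving the minimal period. -/
def MaxCond (n : ℕ) (w : ℕ → A) (i j : ℕ) : Prop :=
  (1 < i → w (i - 1) ≠ w (i + minPer w i j - 1)) ∧
  (j < n → w (j + 1) ≠ w (j - minPer w i j + 1))

/-- `w[i..j]` is a maximal repetition (run) in the word `w` of length `n`. -/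
def IsMaxRepetition (n : ℕ) (w : ℕ → A) (i j : ℕ) : Prop :=
  1 ≤ i ∧ i ≤ j ∧ j ≤ n ∧ 2 * minPer w i j ≤ j - i + 1 ∧ MaxCond n w i j

/-- `w[i..j]` is a maximal subrepetition in the word `w` of length `n`:
its exponent is strictly between 1 and 2 and it satisfies the maximality conditions. -/
def IsMaxSubrepetition (n : ℕ) (w : ℕ → A) (i j : ℕ) : Prop :=
  1 ≤ i ∧ i ≤ j ∧ j ≤ n ∧ minPer w i j < j - i + 1 ∧
    j - i + 1 < 2 * minPer w i j ∧ MaxCond n w i j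

/-- A repeat in the word `w` of length `n`: a pair of equal factors
`w[b1..e1]` (left copy) and `w[b2..e2]` (right copy) with `b1 < b2`. -/
structure WordRepeat (n : ℕ) (w : ℕ → A) where
  b1 : ℕ
  e1 : ℕ
  b2 : ℕ
  e2 : ℕ
  one_le_b1 : 1 ≤ b1
  b1_le_e1 : b1 ≤ e1
  b2_le_e2 : b2 ≤ e2
  e2_le_n : e2 ≤ n
  b1_lt_b2 : b1 < b2
  len_eq : e1 - b1 = e2 - b2
  copies_eq : ∀ k, k ≤ e1 - b1 → w (b1 + k) = w (b2 + k)

namespace WordRepeat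

variable {n : ℕ} {w : ℕ → A}

/-- The period of the repeat. -/
def p (σ : WordRepeat n w) : ℕ := σ.b2 - σ.b1

/-- The length of the copies of the repeat. -/
def c (σ : WordRepeat n w) : ℕ := σ.e1 - σ.b1 + 1

/-- The repeat is maximal: its copies cannot be simultaneously extended to the left
or to the right preserving the period. (`fact σ = w[b1..e2]`.) -/
def Maximal (σ : WordRepeat n w) : Prop :=
  (1 < σ.b1 → w (σ.b1 - 1) ≠ w (σ.b2 - 1)) ∧
  (σ.e2 < n → w (σ.e1 + 1) ≠ w (σ.e2 + 1))

/-- The repeat is overlapped: its copies are overlapped factors. -/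
def Overlapped (σ : WordRepeat n w) : Prop := σ.b2 ≤ σ.e1 + 1

/-- The repeat is gapped: there is a nonempty gap between its copies. -/
def Gapped (σ : WordRepeat n w) : Prop := σ.e1 + 1 < σ.b2

/-- The repeat is `α`-gapped: it is gapped and `p(σ) ≤ α ⬝ c(σ)`. -/
def AlphaGapped (α : ℝ) (σ : WordRepeat n w) : Prop :=
  σ.Gapped ∧ (σ.p : ℝ) ≤ α * (σ.c : ℝ)

/-- `σ` is covered by `σ'`: `fact σ = w[σ.b1..σ.e2]` is contained in
`fact σ' = w[σ'.b1..σ'.e2]` and `p(σ') < p(σ)`. -/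
def CoveredBy (σ σ' : WordRepeat n w) : Prop :=
  σ'.b1 ≤ σ.b1 ∧ σ.e2 ≤ σ'.e2 ∧ σ'.p < σ.p

end WordRepeat

/-- `σ` is the principal repeat of some maximal repetition of `w`
(a reprincipal repeat). -/
def IsPrincipalOfMaxRepetition {n : ℕ} {w : ℕ → A} (σ : WordRepeat n w) : Prop :=
  ∃ i j, IsMaxRepetition n w i j ∧ σ.b1 = i ∧ σ.e1 = j - minPer w i j ∧
    σ.b2 = i + minPer w i j ∧ σ.e2 = j

/-- `σ` is principal: it is the principal repeat of some maximal repetition or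
maximal subrepetition of `w`. -/
def IsPrincipal {n : ℕ} {w : ℕ → A} (σ : WordRepeat n w) : Prop :=
  ∃ i j, (IsMaxRepetition n w i j ∨ IsMaxSubrepetition n w i j) ∧ σ.b1 = i ∧
    σ.e1 = j - minPer w i j ∧ σ.b2 = i + minPer w i j ∧ σ.e2 = j

/-- `σ` is a periodic repeat: its copies are repetitions whose minimal period
is at most `c(σ)/3`. -/
def IsPeriodicRepeat {n : ℕ} {w : ℕ → A} (σ : WordRepeat n w) : Prop :=
  3 * minPer w σ.b1 σ.e1 ≤ σ.c

/-- The periodic repeat `σ` is represented by the maximal repetition `w[i..j]`: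
both copies of `σ` extend (preserving their minimal period) to `w[i..j]`;
equivalently, `w[i..j]` is a maximal repetition whose minimal period equals the
minimal period of the copies of `σ` and which contains both copies of `σ`. -/
def RepresentedBy {n : ℕ} {w : ℕ → A} (σ : WordRepeat n w) (i j : ℕ) : Prop :=
  IsPeriodicRepeat σ ∧ IsMaxRepetition n w i j ∧
  minPer w i j = minPer w σ.b1 σ.e1 ∧ i ≤ σ.b1 ∧ σ.e2 ≤ j

/-- The periodic repeat `σ` is represented by the pair of distinct maximal repetitions
`w[i1..j1]`, `w[i2..j2]`: the left copy of `σ` extends to `w[i1..j1]`, the right copy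
extends to `w[i2..j2]`, the two repetitions being distinct (`σ` is birepresented). -/
def RepresentedByPair {n : ℕ} {w : ℕ → A} (σ : WordRepeat n w)
    (i1 j1 i2 j2 : ℕ) : Prop :=
  IsPeriodicRepeat σ ∧ IsMaxRepetition n w i1 j1 ∧ IsMaxRepetition n w i2 j2 ∧
  minPer w i1 j1 = minPer w σ.b1 σ.e1 ∧ minPer w i2 j2 = minPer w σ.b1 σ.e1 ∧
  i1 ≤ σ.b1 ∧ σ.e1 ≤ j1 ∧ i2 ≤ σ.b2 ∧ σ.e2 ≤ j2 ∧ ¬(i1 = i2 ∧ j1 = j2)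

theorem IsPeriodOf.eq_add_mul {A : Type*} {w : ℕ → A} {i j p : ℕ} (h : IsPeriodOf w i j p)
    {k t : ℕ} (hk : i ≤ k) (hkt : k + t * p ≤ j) : w k = w (k + t * p) := by
  induction t with
  | zero => simp
  | succ t ih =>
    rw [Nat.succ_mul, ← add_assoc] at hkt ⊢
    rw [ih (by omega), h.2.2 (k + t * p) (by omega) hkt]

theorem IsPeriodOf.sub {A : Type*} {w : ℕ → A} {i j p q : ℕ} (hp : IsPeriodOf w i j p)
    (hq : IsPeriodOf w i j q) (hqp : q < p) (hpq : p + q ≤ j - i + 1) :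
    IsPeriodOf w i j (p - q) := by
  obtain ⟨-, hp, hwp⟩ := hp
  obtain ⟨hq, -, hwq⟩ := hq
  refine ⟨by omega, by omega, fun k hik hkj => ?_⟩
  by_cases hk : k + p ≤ j
  · rw [hwp k hik hk, hwq (k + (p - q)) (by omega) (by omega)]
    congr 1
    omega
  · have h₁ := hwq (k - q) (by omega) (by omega)
    have h₂ := hwp (k - q) (by omega) (by omega)
    rw [show k - q + q = k by omega] at h₁
    rw [← h₁, h₂]
    congr 1
    omega

theorem IsPeriodOf.minPer {A : Type*} {w : ℕ → A} {i j p : ℕ} (h : IsPeriodOf w i j p) :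
    IsPeriodOf w i j (minPer w i j) :=
  Nat.sInf_mem (s := {p | IsPeriodOf w i j p}) ⟨p, h⟩

theorem IsPeriodOf.minPer_le {A : Type*} {w : ℕ → A} {i j p : ℕ} (h : IsPeriodOf w i j p) :
    _root_.minPer w i j ≤ p :=
  Nat.sInf_le h

theorem IsPeriodOf.minPer_dvd {A : Type*} {w : ℕ → A} {i j p : ℕ} (h : IsPeriodOf w i j p)
    (hp : p + _root_.minPer w i j ≤ j - i + 1) : _root_.minPer w i j ∣ p := by
  induction p using Nat.strong_induction_on with
  | _ p ih =>
    have hm := h.minPer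
    rcases h.minPer_le.eq_or_lt with heq | hlt
    · exact heq.dvd
    · have hdvd := ih _ (Nat.sub_lt h.1 hm.1) (h.sub hm hlt hp) (by omega)
      exact (Nat.dvd_sub_iff_left hlt.le dvd_rfl).mp hdvd

theorem WordRepeat.isPeriodOf {A : Type*} {n : ℕ} {w : ℕ → A} (σ : WordRepeat n w) :
    IsPeriodOf w σ.b1 σ.e2 σ.p := by
  obtain ⟨b1, e1, b2, e2, h1, h2, h3, h4, h5, h6, hw⟩ := σ
  dsimp only [WordRepeat.p]
  refine ⟨by omega, by omega, fun k hk hke => ?_⟩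
  have := hw (k - b1) (by omega)
  rwa [show b1 + (k - b1) = k by omega, show b2 + (k - b1) = k + (b2 - b1) by omega] at this

/-- If `σ` is a maximal overlapped repeat in the word `w` of length `n`, then
`fact σ = w[σ.b1..σ.e2]` is a maximal repetition in `w` whose minimal period
divides `p(σ)`. -/
theorem fact_of_maximal_overlapped_is_max_repetition {A : Type*} (n : ℕ) (w : ℕ → A)
    (σ : WordRepeat n w) (hmax : σ.Maximal) (hover : σ.Overlapped) :
    IsMaxRepetition n w σ.b1 σ.e2 ∧ minPer w σ.b1 σ.e2 ∣ σ.p := by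
  have hp := σ.isPeriodOf
  have hm := hp.minPer
  have hle := hp.minPer_le
  have hpσ : σ.p = σ.b2 - σ.b1 := rfl
  have h₁ := σ.one_le_b1
  have h₂ := σ.b1_le_e1
  have h₃ := σ.b2_le_e2
  have h₄ := σ.b1_lt_b2
  have h₅ := σ.len_eq
  unfold WordRepeat.Overlapped at hover
  have hdvd : minPer w σ.b1 σ.e2 ∣ σ.p := hp.minPer_dvd (by omega)
  refine ⟨⟨h₁, by omega, σ.e2_le_n, by omega, ?_, ?_⟩, hdvd⟩ <;>
    obtain ⟨d, hd⟩ := hdvd <;>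
    generalize minPer w σ.b1 σ.e2 = m at * <;>
    obtain ⟨t, rfl⟩ : ∃ t, d = t + 1 :=
      Nat.exists_eq_succ_of_ne_zero (by rintro rfl; omega) <;>
    have hdt : σ.p = t * m + m := by rw [hd]; ring
  · intro hb heq
    refine hmax.1 hb (heq.trans ?_)
    have hm₁ := hm.1
    rw [hm.eq_add_mul (k := σ.b1 + m - 1) (t := t) (by omega) (by omega)]
    congr 1
    omega
  · intro he heq
    refine hmax.2 he (Eq.trans ?_ heq.symm)
    have hm₁ := hm.1
    rw [hm.eq_add_mul (k := σ.e1 + 1) (t := t) (by omega) (by omega)]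
    congr 1
    omega
end

section
/- Let 0 < δ < 1 and let r be a maximal δ-subrepetition in a word w. Then the repeat σ with left copy w[beg(r)..end(r)−p(r)] and right copy w[beg(r)+p(r)..end(r)] is a maximal gapped repeat with p(σ) = p(r) and p(σ) ≤ c(σ)/δ (i.e., σ is (1/δ)-gapped). Moreover, the map sending each maximal δ-subrepetition to this repeat is injective, so distinct maximal δ-subrepetitions of w give distinct maximal (1/δ)-gapped repeats. -/
variable {A : Type*}

/-- For `0 < δ < 1`, a factor `w[i..j]` is a maximal `δ`-subrepetition if
`1 + δ ≤ e(w[i..j]) < 2` and it satisfies the maximality conditions. -/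
def IsMaxDeltaSubrepetition {A : Type*} (δ : ℝ) (n : ℕ) (w : ℕ → A) (i j : ℕ) : Prop :=
  1 ≤ i ∧ i ≤ j ∧ j ≤ n ∧
  (1 + δ) * (minPer w i j : ℝ) ≤ ((j - i + 1 : ℕ) : ℝ) ∧
  ((j - i + 1 : ℕ) : ℝ) < 2 * (minPer w i j : ℝ) ∧ MaxCond n w i j

theorem isPeriodOf_minPer {A : Type*} (w : ℕ → A) (i j : ℕ) :
    IsPeriodOf w i j (minPer w i j) :=
  Nat.sInf_mem (s := {p | IsPeriodOf w i j p})
    ⟨j - i + 1, by omega, le_rfl, fun _ _ _ => by omega⟩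

/-- For a maximal `δ`-subrepetition `r = w[i..j]`, the repeat with left copy
`w[i..j-p(r)]` and right copy `w[i+p(r)..j]` is a maximal gapped repeat `σ` with
`p(σ) = p(r)` and `p(σ) ≤ c(σ)/δ` (i.e. a maximal `(1/δ)`-gapped repeat); moreover,
the map sending each maximal `δ`-subrepetition to this repeat is injective. -/
theorem principal_repeat_of_max_delta_subrepetition {A : Type*} (δ : ℝ)
    (hδ0 : 0 < δ) (hδ1 : δ < 1) (n : ℕ) (w : ℕ → A) (i j : ℕ)
    (h : IsMaxDeltaSubrepetition δ n w i j) :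
    (∃ σ : WordRepeat n w,
      σ.b1 = i ∧ σ.e1 = j - minPer w i j ∧ σ.b2 = i + minPer w i j ∧ σ.e2 = j ∧
      σ.Maximal ∧ σ.Gapped ∧ σ.p = minPer w i j ∧
      (σ.p : ℝ) ≤ (σ.c : ℝ) / δ) ∧
    (∀ i' j', IsMaxDeltaSubrepetition δ n w i' j' →
      (i = i' ∧ j - minPer w i j = j' - minPer w i' j' ∧
        i + minPer w i j = i' + minPer w i' j' ∧ j = j') →
      i = i' ∧ j = j') := by
  obtain ⟨hi, hij, hjn, hlow, hupp, hleft, hright⟩ := h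
  obtain ⟨hpos, -, hper⟩ := isPeriodOf_minPer w i j
  generalize minPer w i j = q at *
  have hq : (1 : ℝ) ≤ q := by exact_mod_cast hpos
  have hlt : q < j - i + 1 := by
    have : (q : ℝ) < ((j - i + 1 : ℕ) : ℝ) := by nlinarith
    exact_mod_cast this
  have hlt2 : j - i + 1 < 2 * q := by exact_mod_cast hupp
  refine ⟨⟨⟨i, j - q, i + q, j, hi, by omega, by omega, hjn, by omega, by omega, fun k hk => ?_⟩,
    rfl, rfl, rfl, rfl, ⟨hleft, fun hj => (hright hj).symm⟩, ?_, ?_, ?_⟩,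
    fun _ _ _ h => ⟨h.1, h.2.2.2⟩⟩
  · rw [hper (i + k) (by omega) (by omega), Nat.add_right_comm]
  · change j - q + 1 < i + q
    omega
  · change i + q - i = q
    exact Nat.add_sub_cancel_left _ _
  · change ((i + q - i : ℕ) : ℝ) ≤ ((j - q - i + 1 : ℕ) : ℝ) / δ
    have hc : ((j - i + 1 : ℕ) : ℝ) = ((j - q - i + 1 : ℕ) : ℝ) + q := by
      rw [← Nat.cast_add]
      congr 1
      omega
    rw [Nat.add_sub_cancel_left, le_div_iff₀ hδ0]
    linarith
end

section
/- Let α ≥ 1. If a maximal α-gapped repeat σ in a word w is covered by a maximal repeat σ′, then σ′ is either an overlapped repeat or an α-gapped repeat. -/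
variable {A : Type*}

/-- If a maximal `α`-gapped repeat `σ` is covered by a maximal repeat `σ'`,
then `σ'` is overlapped or `α`-gapped. -/
theorem covering_repeat_overlapped_or_alpha_gapped {A : Type*} (α : ℝ) (hα : 1 ≤ α)
    (n : ℕ) (w : ℕ → A) (σ σ' : WordRepeat n w)
    (hσ : σ.Maximal) (hσgap : σ.AlphaGapped α)
    (hσ' : σ'.Maximal) (hcov : σ.CoveredBy σ') :
    σ'.Overlapped ∨ σ'.AlphaGapped α := by
  obtain ⟨-, hp⟩ := hσgap
  obtain ⟨hb, he, hlt⟩ := hcov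
  by_cases ho : σ'.Overlapped
  · exact Or.inl ho
  refine Or.inr ⟨not_le.mp ho, ?_⟩
  have hc : σ.c ≤ σ'.c := by
    have := σ.b1_le_e1
    have := σ.b2_le_e2
    have := σ.b1_lt_b2
    have := σ.len_eq
    have := σ'.b1_le_e1
    have := σ'.b2_le_e2
    have := σ'.b1_lt_b2
    have := σ'.len_eq
    unfold WordRepeat.p at hlt
    unfold WordRepeat.c
    omega
  calc (σ'.p : ℝ) ≤ σ.p := by exact_mod_cast hlt.le
    _ ≤ α * σ.c := hp
    _ ≤ α * σ'.c := by gcongr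
end

section
/- Let α ≥ 1. Any α-periodic maximal repeat σ in a word w that is represented by a maximal repetition r is covered by the principal repeat of r, and this principal repeat is α-nonperiodic. -/
variable {A : Type*}

/-- The minimal period does not increase when passing to a subfactor. -/
theorem minPer_le_minPer_of_subfactor {A : Type*} (w : ℕ → A) {i j a b : ℕ}
    (hia : i ≤ a) (hbj : b ≤ j) : minPer w a b ≤ minPer w i j := by
  obtain ⟨hpos, -, hper⟩ := isPeriodOf_minPer w i j
  by_cases hle : minPer w i j ≤ b - a + 1
  · exact Nat.sInf_le
      ⟨hpos, hle, fun k hk hkb => hper k (hia.trans hk) (hkb.trans hbj)⟩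
  · have := (isPeriodOf_minPer w a b).2.1
    omega

/-- Any `α`-periodic maximal repeat `σ` represented by a maximal repetition `w[i..j]`
is covered by the principal repeat of `w[i..j]`, and this principal repeat is
`α`-nonperiodic. -/
theorem alpha_periodic_covered_by_nonperiodic_principal {A : Type*} (α : ℝ)
    (hα : 1 ≤ α) (n : ℕ) (w : ℕ → A) (σ : WordRepeat n w) (i j : ℕ)
    (hσmax : σ.Maximal)
    (hαper : (minPer w σ.b1 σ.e1 : ℝ) ≤ (σ.p : ℝ) / (3 * α))
    (hrep : RepresentedBy σ i j) :
    ∃ τ : WordRepeat n w,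
      τ.b1 = i ∧ τ.e1 = j - minPer w i j ∧ τ.b2 = i + minPer w i j ∧ τ.e2 = j ∧
      σ.CoveredBy τ ∧ (τ.p : ℝ) / (3 * α) < (minPer w τ.b1 τ.e1 : ℝ) := by
  obtain ⟨-, ⟨hi, hij, hjn, hexp, -⟩, hmin, hib, hej⟩ := hrep
  obtain ⟨hpos, -, hper⟩ := isPeriodOf_minPer w i j
  rw [← hmin] at hαper
  have hα0 : (0 : ℝ) < 3 * α := by linarith
  have hpos' : (1 : ℝ) ≤ (minPer w i j : ℝ) := by exact_mod_cast hpos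
  have hlt : minPer w i j < σ.p := by
    rw [le_div_iff₀ hα0] at hαper
    have : (minPer w i j : ℝ) < σ.p := by nlinarith
    exact_mod_cast this
  have hp : σ.p = σ.b2 - σ.b1 := rfl
  have hb := σ.b1_lt_b2
  have hlen := σ.len_eq
  have h1 := σ.b1_le_e1
  have h2 := σ.b2_le_e2
  refine ⟨⟨i, j - minPer w i j, i + minPer w i j, j, hi, by omega, by omega, hjn, by omega,
    by omega, fun k hk => ?_⟩, rfl, rfl, rfl, rfl, ⟨hib, hej, ?_⟩, ?_⟩
  · rw [hper (i + k) (by omega) (by omega)]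
    congr 1
    omega
  · simpa [WordRepeat.p] using hlt
  · have hle : minPer w i j ≤ minPer w i (j - minPer w i j) := by
      conv_lhs => rw [hmin]
      exact minPer_le_minPer_of_subfactor w hib (by omega)
    have hle' : (minPer w i j : ℝ) ≤ minPer w i (j - minPer w i j) := by exact_mod_cast hle
    simp only [WordRepeat.p, Nat.add_sub_cancel_left]
    refine lt_of_lt_of_le ?_ hle'
    rw [div_lt_iff₀ hα0]
    nlinarith
end

section
/- If a maximal gapped repeat σ in a word w is covered by a maximal gapped repeat σ′, then p(σ) ≥ p(σ′) > p(σ)/2. -/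
variable {A : Type*}

/-- If a maximal gapped repeat `σ` is covered by a maximal gapped repeat `σ'`, then
`p(σ) ≥ p(σ') > p(σ)/2`. -/
theorem period_bounds_of_gapped_covered_by_gapped {A : Type*} (n : ℕ) (w : ℕ → A)
    (σ σ' : WordRepeat n w) (hσ : σ.Maximal) (hσ' : σ'.Maximal)
    (hg : σ.Gapped) (hg' : σ'.Gapped) (hcov : σ.CoveredBy σ') :
    σ'.p ≤ σ.p ∧ σ.p < 2 * σ'.p := by
  obtain ⟨hb, he, hp⟩ := hcov
  have hlen := σ'.len_eq
  have hle := σ'.b1_le_e1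
  have hle' := σ'.b2_le_e2
  have hσle := σ.b2_le_e2
  simp only [WordRepeat.Gapped, WordRepeat.p] at *
  omega
end
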